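/- Let 2 ≤ k ≤ n be integers and let α_0, α_1, …, α_{k−2} be nonnegative real numbers. Then the function G(λ) = σ_k(λ)/σ_{k−1}(λ) − Σ_{l=0}^{k−2} α_l·σ_l(λ)/σ_{k−1}(λ) is concave on the Gårding cone Γ_k (which is a convex subset of ℝⁿ). -/

import Mathlib

/-- The `m`-th elementary symmetric function of `λ = (λ_1, …, λ_n) ∈ ℝⁿ`. -/
def esymm (n m : ℕ) (lam : Fin n → ℝ) : ℝ :=
  ∑ s ∈ (Finset.univ : Finset (Fin n)).powersetCard m, ∏ i ∈ s, lam i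

/-- The Gårding cone `Γ_k = {λ ∈ ℝⁿ : σ_j(λ) > 0 for all 1 ≤ j ≤ k}`. -/
def GardingCone (n m : ℕ) : Set (Fin n → ℝ) :=
  {lam | ∀ j : ℕ, 1 ≤ j → j ≤ m → 0 < esymm n j lam}

open Polynomial in
/-- The derivative of a real-rooted polynomial is real-rooted. -/
theorem Polynomial.Splits.derivative_real {p : ℝ[X]} (hp : p.Splits) :
    (derivative p).Splits := by
  rw [splits_iff_card_roots] at hp ⊢
  have h1 := card_roots_le_derivative p
  have h2 := natDegree_derivative_le p
  have h3 := card_roots' (derivative p)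
  rcases Nat.eq_zero_or_pos p.natDegree with h0 | h0 <;> omega

open Polynomial in
/-- Laguerre's inequality at the origin. -/
theorem Polynomial.Splits.two_mul_coeff_zero_mul_coeff_two_le {p : ℝ[X]} (hp : p.Splits) :
    2 * (p.coeff 0 * p.coeff 2) ≤ p.coeff 1 ^ 2 := by
  obtain ⟨m, hm⟩ := splits_iff_exists_multiset.1 hp
  rw [hm]
  generalize p.leadingCoeff = c
  clear hm hp
  induction m using Multiset.induction_on with
  | empty => simp [coeff_C]
  | cons a m ih =>
    rw [Multiset.map_cons, Multiset.prod_cons, mul_left_comm (C c)]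
    generalize C c * (Multiset.map (fun a ↦ X - C a) m).prod = q at ih ⊢
    have h0 : ((X - C a) * q).coeff 0 = -a * q.coeff 0 := by simp [mul_coeff_zero]
    have h1 : ((X - C a) * q).coeff 1 = q.coeff 0 - a * q.coeff 1 := by
      rw [sub_mul, coeff_sub, coeff_X_mul, coeff_C_mul]
    have h2 : ((X - C a) * q).coeff 2 = q.coeff 1 - a * q.coeff 2 := by
      rw [sub_mul, coeff_sub, coeff_X_mul, coeff_C_mul]
    rw [h0, h1, h2]
    nlinarith [sq_nonneg (q.coeff 0), mul_le_mul_of_nonneg_left ih (sq_nonneg a)]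

open Polynomial in
/-- Newton's inequality for the coefficients of a real-rooted polynomial. -/
theorem Polynomial.Splits.coeff_mul_coeff_le {p : ℝ[X]} (hp : p.Splits) (j : ℕ) :
    (j + 2) * (p.coeff j * p.coeff (j + 2)) ≤ (j + 1) * p.coeff (j + 1) ^ 2 := by
  induction j generalizing p with
  | zero => simpa using hp.two_mul_coeff_zero_mul_coeff_two_le
  | succ j ih =>
    have h := ih hp.derivative_real
    simp only [coeff_derivative] at h
    push_cast at h ⊢
    have hj : (0 : ℝ) < (j + 1) * (j + 2) := by positivity
    refine le_of_mul_le_mul_left ?_ hj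
    convert! h using 1 <;> ring_nf

section Esymm

variable {ι : Type*}

/-- The elementary symmetric function of the variables indexed by `s`. -/
def esymmOn (s : Finset ι) (m : ℕ) (x : ι → ℝ) : ℝ :=
  ∑ t ∈ s.powersetCard m, ∏ i ∈ t, x i

/-- The Gårding cone in the variables indexed by `s`. -/
def gardingConeOn (s : Finset ι) (k : ℕ) : Set (ι → ℝ) :=
  {x | ∀ j ≤ k, 0 < esymmOn s j x}

theorem esymmOn_zero (s : Finset ι) (x : ι → ℝ) : esymmOn s 0 x = 1 := by
  simp [esymmOn]

open Polynomial in
theorem esymmOn_eq_coeff (s : Finset ι) (m : ℕ) (x : ι → ℝ) :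
    esymmOn s m x = (∏ i ∈ s, (1 + C (x i) * X)).coeff m := by
  have h (t : Finset ι) : (∏ i ∈ t, C (x i) * X) = C (∏ i ∈ t, x i) * X ^ t.card := by
    rw [Finset.prod_mul_distrib, Finset.prod_const, map_prod]
  simp only [Finset.prod_one_add, h, finsetSum_coeff, coeff_C_mul_X_pow]
  rw [esymmOn, ← Finset.sum_filter]
  refine Finset.sum_congr ?_ fun _ _ => rfl
  ext t
  simp [Finset.mem_powersetCard, eq_comm]

open Polynomial in
/-- Newton's inequality, without the sharp constant. -/
theorem esymmOn_mul_esymmOn_le (s : Finset ι) (m : ℕ) (x : ι → ℝ) :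
    esymmOn s m x * esymmOn s (m + 2) x ≤ esymmOn s (m + 1) x ^ 2 := by
  have hp : (∏ i ∈ s, (1 + C (x i) * X)).Splits := by
    refine Splits.prod fun i _ => Splits.of_natDegree_le_one ?_
    compute_degree
  have h := hp.coeff_mul_coeff_le m
  simp only [← esymmOn_eq_coeff] at h
  have hm : (0 : ℝ) ≤ m := m.cast_nonneg
  by_contra! hlt
  nlinarith [sq_nonneg (esymmOn s (m + 1) x)]

theorem gardingConeOn_anti (s : Finset ι) {j k : ℕ} (h : j ≤ k) :
    gardingConeOn s k ⊆ gardingConeOn s j :=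
  fun _ hx i hi => hx i (hi.trans h)

variable [DecidableEq ι]

open Polynomial in
theorem esymmOn_succ_eq {s : Finset ι} {i : ι} (hi : i ∈ s) (m : ℕ) (x : ι → ℝ) :
    esymmOn s (m + 1) x =
      x i * esymmOn (s.erase i) m x + esymmOn (s.erase i) (m + 1) x := by
  simp only [esymmOn_eq_coeff]
  rw [← Finset.mul_prod_erase s _ hi, add_mul, one_mul, coeff_add, mul_assoc, coeff_C_mul,
    coeff_X_mul, add_comm]

open Polynomial in
theorem sum_mul_esymmOn_erase (s : Finset ι) (m : ℕ) (x : ι → ℝ) :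
    ∑ i ∈ s, x i * esymmOn (s.erase i) m x = (m + 1) * esymmOn s (m + 1) x := by
  have h := congrArg (fun p : ℝ[X] => p.coeff m)
    (derivative_prod_finset (s := s) (f := fun i => 1 + C (x i) * X))
  simp only [coeff_derivative, finsetSum_coeff, ← esymmOn_eq_coeff] at h
  rw [mul_comm, h]
  refine Finset.sum_congr rfl fun i _ => ?_
  rw [esymmOn_eq_coeff]
  simp only [derivative_add, derivative_one, zero_add, derivative_C_mul, derivative_X, mul_one,
    coeff_mul_C]
  ring

theorem mem_gardingConeOn_erase {s : Finset ι} {i : ι} (hi : i ∈ s) {k : ℕ} {x : ι → ℝ}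
    (hx : x ∈ gardingConeOn s (k + 1)) : x ∈ gardingConeOn (s.erase i) k := by
  induction k with
  | zero =>
    intro j hj
    obtain rfl : j = 0 := by omega
    simp [esymmOn_zero]
  | succ k ih =>
    have h := ih (gardingConeOn_anti s (by omega) hx)
    intro j hj
    rcases hj.lt_or_eq with hj | rfl
    · exact h j (by omega)
    · have h0 := h k le_rfl
      have h1 := hx (k + 1) (by omega)
      have h2 := hx (k + 2) (by omega)
      rw [esymmOn_succ_eq hi] at h1 h2
      have hN := esymmOn_mul_esymmOn_le (s.erase i) k x
      by_contra! hle
      generalize esymmOn (s.erase i) k x = a at *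
      generalize esymmOn (s.erase i) (k + 1) x = b at *
      generalize esymmOn (s.erase i) (k + 2) x = c at *
      have h3 : 0 < a * (x i * b + c) := mul_pos h0 h2
      have h4 : 0 ≤ -b * (x i * a + b) := mul_nonneg (by linarith) h1.le
      nlinarith

end Esymm

/-- Joint concavity and monotonicity of the parallel sum `x * y / (x + y)` on `0 < x + y`. -/
theorem parallel_sum_concave {x₁ x₂ y₁ y₂ y a b : ℝ} (h₁ : 0 < x₁ + y₁) (h₂ : 0 < x₂ + y₂)
    (ha : 0 ≤ a) (hb : 0 ≤ b) (hab : a + b = 1) (hy : a * y₁ + b * y₂ ≤ y) :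
    a * (x₁ * y₁ / (x₁ + y₁)) + b * (x₂ * y₂ / (x₂ + y₂)) ≤
      (a * x₁ + b * x₂) * y / ((a * x₁ + b * x₂) + y) := by
  obtain ⟨u, hu⟩ : ∃ u, u = x₁ / (x₁ + y₁) := ⟨_, rfl⟩
  obtain ⟨v, hv⟩ : ∃ v, v = x₂ / (x₂ + y₂) := ⟨_, rfl⟩
  have e₁ : x₁ * y₁ / (x₁ + y₁) = x₁ - (x₁ + y₁) * u ^ 2 := by rw [hu]; field_simp; ring
  have e₂ : x₂ * y₂ / (x₂ + y₂) = x₂ - (x₂ + y₂) * v ^ 2 := by rw [hv]; field_simp; ring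
  have f₁ : x₁ = (x₁ + y₁) * u := by rw [hu]; field_simp
  have f₂ : x₂ = (x₂ + y₂) * v := by rw [hv]; field_simp
  rw [e₁, e₂]
  generalize hz₁ : x₁ + y₁ = z₁ at *
  generalize hz₂ : x₂ + y₂ = z₂ at *
  have hz : 0 < a * z₁ + b * z₂ := by
    rcases ha.lt_or_eq with h | h
    · have := mul_pos h h₁
      have := mul_nonneg hb h₂.le
      linarith
    · have : b = 1 := by linarith
      subst h this
      linarith
  have hzy : a * z₁ + b * z₂ ≤ a * x₁ + b * x₂ + y := by
    rw [← hz₁, ← hz₂]; linarith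
  have hz' := hz.trans_le hzy
  rw [le_div_iff₀ hz']
  have hK : 0 ≤ a * z₁ * u ^ 2 + b * z₂ * v ^ 2 := by positivity
  have hM := mul_le_mul_of_nonneg_left hzy hK
  have hS : (a * x₁ + b * x₂) ^ 2 ≤ (a * z₁ * u ^ 2 + b * z₂ * v ^ 2) * (a * z₁ + b * z₂) := by
    have : 0 ≤ a * b * z₁ * z₂ * (u - v) ^ 2 := by positivity
    rw [f₁, f₂]
    nlinarith
  nlinarith

section Quotients

variable {ι : Type*} [DecidableEq ι]

/-- A finite sum of concave functions is concave. -/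
theorem concaveOn_finset_sum {E κ : Type*} [AddCommGroup E] [Module ℝ E] {S : Set E}
    (hS : Convex ℝ S) (t : Finset κ) (f : κ → E → ℝ) (hf : ∀ i ∈ t, ConcaveOn ℝ S (f i)) :
    ConcaveOn ℝ S (fun x => ∑ i ∈ t, f i x) := by
  refine ⟨hS, fun x hx y hy a b ha hb hab => ?_⟩
  simp only [Finset.smul_sum, ← Finset.sum_add_distrib]
  exact Finset.sum_le_sum fun i hi => (hf i hi).2 hx hy ha hb hab

theorem esymmOn_div_eq_sum_parallel {s : Finset ι} {k : ℕ} {x : ι → ℝ}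
    (hx : x ∈ gardingConeOn s (k + 1)) :
    esymmOn s (k + 2) x / esymmOn s (k + 1) x =
      ((k : ℝ) + 2)⁻¹ * ∑ i ∈ s,
        x i * (esymmOn (s.erase i) (k + 1) x / esymmOn (s.erase i) k x) /
          (x i + esymmOn (s.erase i) (k + 1) x / esymmOn (s.erase i) k x) := by
  have h := sum_mul_esymmOn_erase s (k + 1) x
  have hpos := hx (k + 1) le_rfl
  have hk : (k : ℝ) + 2 ≠ 0 := by positivity
  have hterm : ∀ i ∈ s,
      x i * (esymmOn (s.erase i) (k + 1) x / esymmOn (s.erase i) k x) /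
          (x i + esymmOn (s.erase i) (k + 1) x / esymmOn (s.erase i) k x) =
        x i * esymmOn (s.erase i) (k + 1) x / esymmOn s (k + 1) x := by
    intro i hi
    have h0 := mem_gardingConeOn_erase hi hx k le_rfl
    rw [esymmOn_succ_eq hi] at hpos ⊢
    have : x i + esymmOn (s.erase i) (k + 1) x / esymmOn (s.erase i) k x =
        (x i * esymmOn (s.erase i) k x + esymmOn (s.erase i) (k + 1) x) /
          esymmOn (s.erase i) k x := by field_simp
    rw [this]
    field_simp
  rw [Finset.sum_congr rfl hterm, ← Finset.sum_div, h]
  push_cast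
  field_simp
  ring

/-- The cone is convex, and the quotient of consecutive elementary symmetric functions is
concave on it. -/
theorem concaveOn_esymmOn_div (s : Finset ι) (k : ℕ) :
    ConcaveOn ℝ (gardingConeOn s k) (fun x => esymmOn s (k + 1) x / esymmOn s k x) := by
  induction k generalizing s with
  | zero =>
    have hu : gardingConeOn s 0 = Set.univ := by
      ext x
      simp [gardingConeOn, esymmOn_zero]
    have hf : (fun x : ι → ℝ => esymmOn s (0 + 1) x / esymmOn s 0 x) =
        fun x => ∑ i ∈ s, x i := by
      ext x
      simpa [esymmOn_zero] using (sum_mul_esymmOn_erase s 0 x).symm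
    rw [hu, hf]
    refine concaveOn_finset_sum convex_univ s (fun i (x : ι → ℝ) => x i) fun i _ => ?_
    exact ⟨convex_univ, fun x _ y _ a b _ _ _ => by simp⟩
  | succ k ih =>
    have hC : gardingConeOn s (k + 1) =
        {x ∈ gardingConeOn s k | 0 < esymmOn s (k + 1) x / esymmOn s k x} := by
      ext x
      constructor
      · exact fun hx => ⟨gardingConeOn_anti s (by omega) hx,
          div_pos (hx _ le_rfl) (hx _ (by omega))⟩
      · rintro ⟨hx, hq⟩ j hj
        rcases hj.lt_or_eq with hj | rfl
        · exact hx j (by omega)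
        · exact (div_pos_iff_of_pos_right (hx k le_rfl)).1 hq
    have hconv : Convex ℝ (gardingConeOn s (k + 1)) := by
      rw [hC]
      exact (ih s).convex_gt 0
    have key := (concaveOn_finset_sum hconv s (fun i x =>
        x i * (esymmOn (s.erase i) (k + 1) x / esymmOn (s.erase i) k x) /
          (x i + esymmOn (s.erase i) (k + 1) x / esymmOn (s.erase i) k x)) ?_).smul
      (c := ((k : ℝ) + 2)⁻¹) (by positivity)
    · exact key.congr fun x hx => (esymmOn_div_eq_sum_parallel hx).symm
    · intro i hi
      have hpos : ∀ x ∈ gardingConeOn s (k + 1),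
          0 < x i + esymmOn (s.erase i) (k + 1) x / esymmOn (s.erase i) k x := by
        intro x hx
        have h0 := mem_gardingConeOn_erase hi hx k le_rfl
        have h1 := hx (k + 1) le_rfl
        rw [esymmOn_succ_eq hi] at h1
        have := div_pos h1 h0
        rwa [add_div, mul_div_cancel_right₀ _ h0.ne'] at this
      refine ⟨hconv, fun x hx y hy a b ha hb hab => ?_⟩
      simpa using parallel_sum_concave (hpos x hx) (hpos y hy) ha hb hab
        ((ih (s.erase i)).2 (mem_gardingConeOn_erase hi hx)
          (mem_gardingConeOn_erase hi hy) ha hb hab)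

theorem convex_gardingConeOn (s : Finset ι) (k : ℕ) : Convex ℝ (gardingConeOn s k) :=
  (concaveOn_esymmOn_div s k).1

theorem ConcaveOn.log {E : Type*} [AddCommGroup E] [Module ℝ E] {S : Set E} {f : E → ℝ}
    (hf : ConcaveOn ℝ S f) (hpos : ∀ x ∈ S, 0 < f x) :
    ConcaveOn ℝ S (fun x => Real.log (f x)) := by
  refine ⟨hf.1, fun x hx y hy a b ha hb hab => ?_⟩
  have hlog := strictConcaveOn_log_Ioi.concaveOn
  have hmem := hlog.1 (hpos x hx) (hpos y hy) ha hb hab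
  exact (hlog.2 (hpos x hx) (hpos y hy) ha hb hab).trans
    (Real.log_le_log hmem (hf.2 hx hy ha hb hab))

theorem concaveOn_log_esymmOn_div (s : Finset ι) (l d : ℕ) :
    ConcaveOn ℝ (gardingConeOn s (l + d))
      (fun x => Real.log (esymmOn s (l + d) x / esymmOn s l x)) := by
  induction d with
  | zero =>
    refine (concaveOn_const 0 (convex_gardingConeOn s _)).congr fun x hx => ?_
    simp [div_self (hx l le_rfl).ne']
  | succ d ih =>
    have hsub := gardingConeOn_anti s (show l + d ≤ l + (d + 1) by omega)
    have hconv := convex_gardingConeOn s (l + (d + 1))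
    have hq := ((concaveOn_esymmOn_div s (l + d)).subset hsub hconv).log
      fun x hx => div_pos (hx _ le_rfl) (hx _ (by omega))
    refine ((ih.subset hsub hconv).add hq).congr fun x hx => ?_
    have h0 := hx l (by omega)
    have h1 := hx (l + d) (by omega)
    have h2 := hx (l + d + 1) (by omega)
    simp only [Pi.add_apply]
    rw [← Real.log_mul (div_pos h1 h0).ne' (div_pos h2 h1).ne', ← add_assoc]
    congr 1
    field_simp

theorem convexOn_esymmOn_div (s : Finset ι) {l m : ℕ} (hlm : l ≤ m) :
    ConvexOn ℝ (gardingConeOn s m) (fun x => esymmOn s l x / esymmOn s m x) := by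
  obtain ⟨d, rfl⟩ := Nat.exists_eq_add_of_le hlm
  have h := (concaveOn_log_esymmOn_div s l d).neg
  have heq : ∀ x ∈ gardingConeOn s (l + d), esymmOn s l x / esymmOn s (l + d) x =
      Real.exp (-Real.log (esymmOn s (l + d) x / esymmOn s l x)) := by
    intro x hx
    rw [Real.exp_neg, Real.exp_log (div_pos (hx _ le_rfl) (hx _ (by omega))), inv_div]
  refine ⟨h.1, fun x hx y hy a b ha hb hab => ?_⟩
  simp only [heq x hx, heq y hy, heq _ (h.1 hx hy ha hb hab)]
  exact (Real.exp_le_exp.2 (h.2 hx hy ha hb hab)).trans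
    (convexOn_exp.2 (Set.mem_univ _) (Set.mem_univ _) ha hb hab)

end Quotients

theorem gardingCone_eq (n k : ℕ) : GardingCone n k = gardingConeOn Finset.univ k := by
  ext x
  refine ⟨fun hx j hj => ?_, fun hx j _ hj => hx j hj⟩
  rcases Nat.eq_zero_or_pos j with rfl | h
  · simp [esymmOn_zero]
  · exact hx j h hj

/-- For `2 ≤ k ≤ n` and nonnegative reals `α_0, …, α_{k-2}`, the function
`G(λ) = σ_k(λ)/σ_{k-1}(λ) - Σ_{l=0}^{k-2} α_l·σ_l(λ)/σ_{k-1}(λ)` is concave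
on the Gårding cone `Γ_k`. -/
theorem G_concave (n k : ℕ) (hk : 2 ≤ k) (hkn : k ≤ n) (α : ℕ → ℝ)
    (hα : ∀ l, l ≤ k - 2 → 0 ≤ α l) :
    ConcaveOn ℝ (GardingCone n k)
      (fun lam =>
        esymm n k lam / esymm n (k - 1) lam -
          ∑ l ∈ Finset.range (k - 1), α l * (esymm n l lam / esymm n (k - 1) lam)) := by
  obtain ⟨m, rfl⟩ := Nat.exists_eq_add_of_le' (show 1 ≤ k by omega)
  rw [gardingCone_eq]
  have hsub := gardingConeOn_anti (Finset.univ : Finset (Fin n)) m.le_succ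
  have hconv := convex_gardingConeOn (Finset.univ : Finset (Fin n)) (m + 1)
  have h1 := (concaveOn_esymmOn_div (Finset.univ : Finset (Fin n)) m).subset hsub hconv
  have h2 := concaveOn_finset_sum hconv (Finset.range m)
    (fun l x => -(α l * (esymm n l x / esymm n m x))) fun l hl => by
      have hl' := Finset.mem_range.1 hl
      exact (((convexOn_esymmOn_div (Finset.univ : Finset (Fin n)) hl'.le).subset hsub
        hconv).smul (hα l (by omega))).neg
  refine (h1.add h2).congr fun x _ => ?_
  simp [sub_eq_add_neg, esymm, esymmOn]
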